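/- Let Γ be a countable group, H ⊴ Γ a locally finite normal subgroup, G = Γ/H with quotient homomorphism ρ: Γ → G. Let Γ act minimally, essentially freely and continuously on a zero-dimensional infinite compact metrizable space X such that the orbit space X/H is Hausdorff, and suppose the induced G-action β on X/H is almost finite. Then the Γ-action on X is almost finite in measure. -/

import Mathlib

open scoped Pointwise
open MeasureTheory

namespace Paper

section Basic

variable (G : Type*) [Group G] (X : Type*) [TopologicalSpace X] [MulAction G X]

/-- The action is minimal: every orbit is dense. -/
def Minimal : Prop := ∀ x : X, Dense (MulAction.orbit G x)

/-- The action is topologically free: every nontrivial fixed-point set is nowhere dense. -/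
def TopFree : Prop := ∀ g : G, g ≠ 1 → interior (closure {x : X | g • x = x}) = (∅ : Set X)

variable [MeasurableSpace X]

/-- `μ` is a `G`-invariant Borel probability measure. -/
def InvProb (μ : Measure X) : Prop :=
  IsProbabilityMeasure μ ∧ ∀ g : G, Measure.map (fun x : X => g • x) μ = μ

/-- The action is essentially free. -/
def EssFree : Prop :=
  ∀ g : G, g ≠ 1 → ∀ μ : Measure X, InvProb G X μ → μ {x : X | g • x = x} = 0

/-- The small boundary property. -/
def SBP : Prop :=
  ∀ (x : X) (U : Set X), IsOpen U → x ∈ U →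
    ∃ V : Set X, IsOpen V ∧ x ∈ V ∧ V ⊆ U ∧
      ∀ μ : Measure X, InvProb G X μ → μ (frontier V) = 0

end Basic

/-- `S` is a `(K, ε)`-Følner set: `|KS \ S| < ε |S|`. -/
def IsFolner {G : Type*} [Group G] (K S : Finset G) (ε : ℝ) : Prop :=
  letI := Classical.decEq G
  (((K * S) \ S).card : ℝ) < ε * S.card

/-- Amenability in the Følner sense. -/
def FolnerAmenable (G : Type*) [Group G] : Prop :=
  ∀ (K : Finset G) (ε : ℝ), 0 < ε → ∃ S : Finset G, IsFolner K S ε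

/-- A finite family of towers forming a castle: all levels are pairwise disjoint. -/
def IsCastle (G : Type*) [Group G] (X : Type*) [MulAction G X] {n : ℕ}
    (S : Fin n → Finset G) (B : Fin n → Set X) : Prop :=
  ∀ (i j : Fin n), ∀ s ∈ S i, ∀ t ∈ S j, (i, s) ≠ (j, t) → Disjoint (s • B i) (t • B j)

/-- The union of all levels of a castle. -/
def CastleUnion (G : Type*) [Group G] (X : Type*) [MulAction G X] {n : ℕ}
    (S : Fin n → Finset G) (B : Fin n → Set X) : Set X :=
  ⋃ i, ⋃ s ∈ S i, s • B i

/-- `C ≺ O` : dynamical subordination of a (closed) set `C` to `O`. -/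
def Subord (G : Type*) [Group G] (X : Type*) [TopologicalSpace X] [MulAction G X]
    (C O : Set X) : Prop :=
  ∃ (n : ℕ) (V : Fin n → Set X) (g : Fin n → G),
    (∀ k, IsOpen (V k)) ∧ (C ⊆ ⋃ k, V k) ∧ (∀ k, g k • V k ⊆ O) ∧
      Pairwise fun k l => Disjoint (g k • V k) (g l • V l)

/-- `U ≺ O` for open `U`: every closed subset of `U` is subordinate to `O`. -/
def SubordOpen (G : Type*) [Group G] (X : Type*) [TopologicalSpace X] [MulAction G X]
    (U O : Set X) : Prop :=
  ∀ C : Set X, IsClosed C → C ⊆ U → Subord G X C O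

/-- Dynamical comparison. -/
def DynComparison (G : Type*) [Group G] (X : Type*) [TopologicalSpace X] [MulAction G X]
    [MeasurableSpace X] : Prop :=
  ∀ U O : Set X, IsOpen U → IsOpen O → U.Nonempty → O.Nonempty →
    (∀ μ : Measure X, InvProb G X μ → μ U < μ O) → SubordOpen G X U O

/-- Almost finiteness (Kerr). -/
def AlmostFinite (G X : Type*) [Group G] [MetricSpace X] [MulAction G X] : Prop :=
  ∀ (K : Finset G) (m : ℕ), 0 < m → ∀ ε : ℝ, 0 < ε →
    ∃ (n : ℕ) (S : Fin n → Finset G) (B : Fin n → Set X),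
      IsCastle G X S B ∧ (∀ i, IsOpen (B i)) ∧ (∀ i, IsFolner K (S i) ε) ∧
      (∀ i, ∀ s ∈ S i, Metric.diam (s • B i) < ε) ∧
      ∃ S' : Fin n → Finset G,
        (∀ i, S' i ⊆ S i ∧ ((S' i).card : ℝ) < (S i).card / m) ∧
        Subord G X (Set.univ \ CastleUnion G X S B) (CastleUnion G X S' B)

/-- Almost finiteness in measure (Kerr–Szabó). -/
def AlmostFiniteInMeasure (G X : Type*) [Group G] [MetricSpace X] [MulAction G X]
    [MeasurableSpace X] : Prop :=
  ∀ (K : Finset G) (ε : ℝ), 0 < ε →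
    ∃ (n : ℕ) (S : Fin n → Finset G) (B : Fin n → Set X),
      IsCastle G X S B ∧ (∀ i, IsOpen (B i)) ∧ (∀ i, IsFolner K (S i) ε) ∧
      (∀ i, ∀ s ∈ S i, Metric.diam (s • B i) < ε) ∧
      (⨆ μ : {μ : Measure X // InvProb G X μ},
        (μ : Measure X) (Set.univ \ CastleUnion G X S B)) < ENNReal.ofReal ε

/-- Every finitely generated subgroup is finite. -/
def LocallyFiniteGroup (G : Type*) [Group G] : Prop :=
  ∀ H : Subgroup G, H.FG → (H : Set G).Finite

/-- `G` is virtually `ℤ`. -/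
def VirtuallyZ (G : Type*) [Group G] : Prop :=
  ∃ H : Subgroup G, H.FiniteIndex ∧ Nonempty (H ≃* Multiplicative ℤ)

end Paper

namespace Paper

/-- A closed orbit of a countable group in a compact Hausdorff space is finite. -/
theorem finite_orbit_of_isClosed {G X : Type*} [Group G] [Countable G] [TopologicalSpace X]
    [CompactSpace X] [T2Space X] [MulAction G X] [ContinuousConstSMul G X] (x : X)
    (hx : IsClosed (MulAction.orbit G x)) : (MulAction.orbit G x).Finite := by
  have : CompactSpace (MulAction.orbit G x) := isCompact_iff_compactSpace.mp hx.isCompact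
  have : Countable (MulAction.orbit G x) := (Set.countable_range _).to_subtype
  have : Nonempty (MulAction.orbit G x) := (MulAction.nonempty_orbit x).to_subtype
  obtain ⟨y, hy⟩ := nonempty_interior_of_iUnion_of_closed
    (f := fun y : MulAction.orbit G x => ({y} : Set _)) (fun _ => isClosed_singleton)
    (Set.iUnion_of_singleton _)
  have hyo : IsOpen ({y} : Set (MulAction.orbit G x)) := by
    rw [← interior_eq_iff_isOpen]
    exact (Set.subset_singleton_iff_eq.mp interior_subset).resolve_left hy.ne_empty
  have hopen : ∀ z : MulAction.orbit G x, IsOpen ({z} : Set (MulAction.orbit G x)) := by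
    intro z
    obtain ⟨g, hg⟩ := MulAction.exists_smul_eq G z y
    have hc : Continuous fun w : MulAction.orbit G x => g • w :=
      Continuous.subtype_mk (continuous_subtype_val.const_smul g) _
    convert hyo.preimage hc
    ext w
    simp only [Set.mem_singleton_iff, Set.mem_preimage, ← hg]
    exact (smul_left_cancel_iff g).symm
  have : DiscreteTopology (MulAction.orbit G x) := discreteTopology_iff_isOpen_singleton.mpr hopen
  have := finite_of_compact_of_discrete (X := MulAction.orbit G x)
  exact Set.toFinite _

/-- An essentially free action of a countable group having an invariant probability measure
admits a free point. -/
theorem exists_free_point {G X : Type*} [Group G] [Countable G] [TopologicalSpace X]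
    [MulAction G X] [MeasurableSpace X] (hef : EssFree G X) {μ : Measure X}
    (hμ : InvProb G X μ) : ∃ x : X, ∀ g : G, g ≠ 1 → g • x ≠ x := by
  have := hμ.1
  have h0 : μ (⋃ g : {g : G // g ≠ 1}, {x : X | g.1 • x = x}) = 0 :=
    measure_iUnion_null fun g => hef g.1 g.2 μ hμ
  by_contra! h
  have : (⋃ g : {g : G // g ≠ 1}, {x : X | g.1 • x = x}) = Set.univ := by
    refine Set.eq_univ_of_forall fun x => ?_
    obtain ⟨g, hg, hx⟩ := h x
    exact Set.mem_iUnion.mpr ⟨⟨g, hg⟩, hx⟩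
  rw [this, measure_univ] at h0
  exact one_ne_zero h0

/-- In a minimal action with a free point, every finite normal subgroup acts freely. -/
theorem Minimal.free_of_finite_normal {G X : Type*} [Group G] [TopologicalSpace X] [T2Space X]
    [MulAction G X] [ContinuousConstSMul G X] (hmin : Minimal G X) (H : Subgroup G) [H.Normal]
    [Finite H] {x₀ : X} (hx₀ : ∀ g : G, g ≠ 1 → g • x₀ ≠ x₀) {h : G} (hH : h ∈ H) (h1 : h ≠ 1)
    (x : X) : h • x ≠ x := by
  intro hx
  have hcl : IsClosed (⋃ k : {k : H // k ≠ 1}, {y : X | (k.1 : G) • y = y}) :=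
    isClosed_iUnion_of_finite fun k => isClosed_eq (continuous_const_smul _) continuous_id
  have hsub : MulAction.orbit G x ⊆ ⋃ k : {k : H // k ≠ 1}, {y : X | (k.1 : G) • y = y} := by
    rintro _ ⟨g, rfl⟩
    refine Set.mem_iUnion.mpr ⟨⟨⟨g * h * g⁻¹, Subgroup.Normal.conj_mem ‹_› h hH g⟩, ?_⟩, ?_⟩
    · simpa [Subtype.ext_iff] using h1
    · simp [mul_smul, hx]
  have hx₀' := hcl.closure_subset_iff.mpr hsub (hmin x x₀)
  obtain ⟨k, hk⟩ := Set.mem_iUnion.mp hx₀'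
  exact hx₀ k.1 (by simpa using k.2) hk

/-- Around a point moved by every nontrivial element of a finite subgroup there are clopen
neighbourhoods whose translates by the subgroup are disjoint from them, and which have small
translates by prescribed finitely many elements. -/
theorem exists_isClopen_small {G X : Type*} [Group G] [MetricSpace X] [MulAction G X]
    [ContinuousConstSMul G X]
    (hzd : TopologicalSpace.IsTopologicalBasis {s : Set X | IsClopen s})
    (H : Subgroup G) [Finite H] {x : X} (hfree : ∀ h ∈ H, h ≠ 1 → h • x ≠ x)
    (F : Finset G) {ε : ℝ} (hε : 0 < ε) :
    ∃ P : Set X, IsClopen P ∧ x ∈ P ∧ (∀ s ∈ F, ∀ Q ⊆ P, Metric.diam (s • Q) < ε) ∧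
      ∀ h ∈ H, h ≠ 1 → Disjoint (h • P) P := by
  have h1 : ∀ s ∈ F, ∀ᶠ P in (nhds x).smallSets, ∀ Q ⊆ P, Metric.diam (s • Q) < ε := by
    intro s _
    rw [Filter.eventually_smallSets' fun A B hAB hB Q hQ => hB Q (hQ.trans hAB)]
    refine ⟨(fun y => s • y) ⁻¹' Metric.ball (s • x) (ε / 3),
      (continuous_const_smul s).continuousAt.preimage_mem_nhds
        (Metric.ball_mem_nhds _ (by positivity)), fun Q hQ => ?_⟩
    have hsub : s • Q ⊆ Metric.ball (s • x) (ε / 3) := by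
      rintro _ ⟨y, hy, rfl⟩
      exact hQ hy
    calc Metric.diam (s • Q) ≤ Metric.diam (Metric.ball (s • x) (ε / 3)) :=
          Metric.diam_mono hsub Metric.isBounded_ball
      _ ≤ 2 * (ε / 3) := Metric.diam_ball (by positivity)
      _ < ε := by linarith
  have h2 : ∀ h : H, ∀ᶠ P in (nhds x).smallSets, (h : G) ≠ 1 → Disjoint ((h : G) • P) P := by
    intro h
    rw [Filter.eventually_smallSets' fun A B hAB hB h1 =>
      (hB h1).mono (Set.smul_set_mono hAB) hAB]
    by_cases hh : (h : G) = 1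
    · exact ⟨Set.univ, Filter.univ_mem, fun h' => absurd hh h'⟩
    · obtain ⟨U, V, hU, hV, hxU, hxV, hUV⟩ := t2_separation (hfree h h.2 hh)
      refine ⟨(fun y => (h : G) • y) ⁻¹' U ∩ V, Filter.inter_mem
        ((continuous_const_smul _).continuousAt.preimage_mem_nhds (hU.mem_nhds hxU))
        (hV.mem_nhds hxV), fun _ => hUV.mono ?_ Set.inter_subset_right⟩
      rintro _ ⟨y, hy, rfl⟩
      exact hy.1
  obtain ⟨U, hU, hP⟩ := Filter.eventually_smallSets.mp
    (((Filter.eventually_all_finset F).mpr h1).and (Filter.eventually_all.mpr h2))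
  obtain ⟨P, hPc, hxP, hPU⟩ := hzd.mem_nhds_iff.mp hU
  exact ⟨P, hPc, hxP, (hP P hPU).1, fun h hh => (hP P hPU).2 ⟨h, hh⟩⟩

/-- A finite group acting freely on a compact zero-dimensional space has a fundamental domain
consisting of finitely many small open sets. -/
theorem exists_small_fundamental_domain {G X : Type*} [Group G] [MetricSpace X] [CompactSpace X]
    [MulAction G X] [ContinuousConstSMul G X]
    (hzd : TopologicalSpace.IsTopologicalBasis {s : Set X | IsClopen s})
    (H : Subgroup G) [Finite H] (hfree : ∀ h ∈ H, h ≠ 1 → ∀ x : X, h • x ≠ x)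
    (F : Finset G) {ε : ℝ} (hε : 0 < ε) :
    ∃ (m : ℕ) (D : Fin m → Set X), (∀ k, IsOpen (D k)) ∧
      (∀ k, ∀ s ∈ F, ∀ Q ⊆ D k, Metric.diam (s • Q) < ε) ∧
      (∀ k l, ∀ h ∈ H, (k = l → h ≠ 1) → Disjoint (h • D k) (D l)) ∧
      ∀ x : X, ∃ h ∈ H, ∃ k, h • x ∈ D k := by
  choose P hPc hxP hPF hPH using fun x : X =>
    exists_isClopen_small hzd H (fun h hh h1 => hfree h hh h1 x) F hε
  obtain ⟨t, ht⟩ := CompactSpace.elim_nhds_subcover P fun x => (hPc x).isOpen.mem_nhds (hxP x)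
  let e := t.equivFin.symm
  let Q : Fin t.card → Set X := fun k => P (e k)
  let D : Fin t.card → Set X := fun k =>
    Q k \ ⋃ l : {l // l < k}, ⋃ h : H, (h : G) • Q l
  have hlt : ∀ k l, l < k → ∀ h ∈ H, Disjoint (h • D k) (D l) := by
    intro k l hkl h hh
    rw [Set.disjoint_left]
    rintro _ ⟨y, hy, rfl⟩ hyl
    refine hy.2 (Set.mem_iUnion.mpr ⟨⟨l, hkl⟩, Set.mem_iUnion.mpr ⟨⟨h⁻¹, H.inv_mem hh⟩, ?_⟩⟩)
    exact Set.mem_inv_smul_set_iff.mpr hyl.1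
  refine ⟨t.card, D, fun k => ?_, fun k s hs R hR => hPF _ s hs R (hR.trans Set.sdiff_subset), ?_,
    fun x => ?_⟩
  · exact (hPc _).isOpen.sdiff (isClosed_iUnion_of_finite fun l =>
      isClosed_iUnion_of_finite fun h => (hPc _).isClosed.smul _)
  · intro k l h hh hkl
    rcases lt_trichotomy l k with hlk | rfl | hlk
    · exact hlt k l hlk h hh
    · exact (hPH _ h hh (hkl rfl)).mono (Set.smul_set_mono Set.sdiff_subset) Set.sdiff_subset
    · have := (hlt l k hlk h⁻¹ (H.inv_mem hh)).symm
      rw [← Set.disjoint_smul_set (a := h)] at this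
      simpa using this
  · have hex : ∃ k, ∃ h ∈ H, h • x ∈ Q k := by
      have hx : x ∈ ⋃ y ∈ t, P y := ht ▸ Set.mem_univ x
      simp only [Set.mem_iUnion] at hx
      obtain ⟨y, hy, hxy⟩ := hx
      exact ⟨e.symm ⟨y, hy⟩, 1, H.one_mem, by simpa [Q] using hxy⟩
    obtain ⟨k, ⟨h, hh, hk⟩, hmin⟩ := WellFounded.has_min (wellFounded_lt (α := Fin t.card))
      {k | ∃ h ∈ H, h • x ∈ Q k} hex
    refine ⟨h, hh, k, hk, fun hmem => ?_⟩
    obtain ⟨l, hl⟩ := Set.mem_iUnion.mp hmem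
    obtain ⟨g, hg⟩ := Set.mem_iUnion.mp hl
    refine hmin l ⟨(g : G)⁻¹ * h, H.mul_mem (H.inv_mem g.2) hh, ?_⟩ l.2
    rw [mul_smul]
    exact Set.mem_smul_set_iff_inv_smul_mem.mp hg

theorem InvProb.measure_smul {G X : Type*} [Group G] [TopologicalSpace X] [MulAction G X]
    [ContinuousConstSMul G X] [MeasurableSpace X] [BorelSpace X] {μ : Measure X}
    (hμ : InvProb G X μ) (g : G) {A : Set X} (hA : IsOpen A) : μ (g • A) = μ A := by
  conv_lhs => rw [← hμ.2 g]
  rw [Measure.map_apply (continuous_const_smul g).measurable (hA.smul g).measurableSet,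
    Set.preimage_smul, inv_smul_smul]

theorem IsCastle.mono_shape {G X : Type*} [Group G] [MulAction G X] {n : ℕ}
    {S S' : Fin n → Finset G} {B : Fin n → Set X} (hS : IsCastle G X S B)
    (h : ∀ i, S' i ⊆ S i) : IsCastle G X S' B :=
  fun i j s hs t ht => hS i j s (h i hs) t (h j ht)

theorem IsCastle.measure_castleUnion {G X : Type*} [Group G] [TopologicalSpace X] [MulAction G X]
    [ContinuousConstSMul G X] [MeasurableSpace X] [BorelSpace X] {μ : Measure X}
    (hμ : InvProb G X μ) {n : ℕ} {S : Fin n → Finset G} {B : Fin n → Set X}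
    (hS : IsCastle G X S B) (hB : ∀ i, IsOpen (B i)) :
    μ (CastleUnion G X S B) = ∑ i, (S i).card * μ (B i) := by
  have hmeas : ∀ i, ∀ s : G, MeasurableSet (s • B i) := fun i s => ((hB i).smul s).measurableSet
  rw [CastleUnion, measure_iUnion, tsum_fintype]
  · refine Finset.sum_congr rfl fun i _ => ?_
    rw [measure_biUnion_finset _ fun s _ => hmeas i s]
    · simp [hμ.measure_smul _ (hB i)]
    · exact fun s hs t ht hst => hS i i s hs t ht (by simpa using hst)
  · intro i j hij
    simp only [Function.onFun, Set.disjoint_iUnion_left, Set.disjoint_iUnion_right]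
    exact fun s hs t ht => hS i j _ ‹_› _ ‹_› (by simp [hij])
  · exact fun i => Finset.measurableSet_biUnion _ fun s _ => hmeas i s

theorem Subord.measure_le {G X : Type*} [Group G] [TopologicalSpace X] [MulAction G X]
    [ContinuousConstSMul G X] [MeasurableSpace X] [BorelSpace X] {μ : Measure X}
    (hμ : InvProb G X μ) {C O : Set X} (h : Subord G X C O) : μ C ≤ μ O := by
  obtain ⟨n, V, g, hV, hC, hO, hd⟩ := h
  calc μ C ≤ μ (⋃ k, V k) := measure_mono hC
    _ ≤ ∑ k, μ (V k) := measure_iUnion_fintype_le _ _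
    _ = ∑ k, μ (g k • V k) := by simp [hμ.measure_smul _ (hV _)]
    _ = μ (⋃ k, g k • V k) := by
      rw [measure_iUnion hd fun k => ((hV k).smul _).measurableSet, tsum_fintype]
    _ ≤ μ O := measure_mono (Set.iUnion_subset hO)

/-- The remainder of a castle subordinate to a proportion `1 / m` of it has measure at most
`1 / m`. -/
theorem IsCastle.measure_compl_le {G X : Type*} [Group G] [TopologicalSpace X] [MulAction G X]
    [ContinuousConstSMul G X] [MeasurableSpace X] [BorelSpace X] {μ : Measure X}
    (hμ : InvProb G X μ) {n m : ℕ} (hm : 0 < m) {S S' : Fin n → Finset G} {B : Fin n → Set X}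
    (hS : IsCastle G X S B) (hB : ∀ i, IsOpen (B i))
    (hS' : ∀ i, S' i ⊆ S i ∧ ((S' i).card : ℝ) < (S i).card / m)
    (hsub : Subord G X (Set.univ \ CastleUnion G X S B) (CastleUnion G X S' B)) :
    μ (Set.univ \ CastleUnion G X S B) ≤ (m : ENNReal)⁻¹ := by
  have := hμ.1
  rw [ENNReal.le_inv_iff_mul_le, mul_comm]
  calc m * μ (Set.univ \ CastleUnion G X S B) ≤ m * μ (CastleUnion G X S' B) := by
        exact mul_le_mul' le_rfl (hsub.measure_le hμ)
    _ = ∑ i, (m * (S' i).card : ℕ) * μ (B i) := by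
        rw [(hS.mono_shape fun i => (hS' i).1).measure_castleUnion hμ hB, Finset.mul_sum]
        simp [mul_assoc]
    _ ≤ ∑ i, (S i).card * μ (B i) := by
        gcongr with i
        have h := (hS' i).2
        rw [lt_div_iff₀ (by positivity), mul_comm] at h
        exact_mod_cast h.le
    _ = μ (CastleUnion G X S B) := (hS.measure_castleUnion hμ hB).symm
    _ ≤ 1 := prob_le_one

/-- Invariant probability measures push forward along equivariant continuous maps. -/
theorem InvProb.map {Γ G X Y : Type*} [Group Γ] [Group G] [TopologicalSpace X] [MulAction Γ X]
    [ContinuousConstSMul Γ X] [MeasurableSpace X] [BorelSpace X] [TopologicalSpace Y]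
    [MulAction G Y] [ContinuousConstSMul G Y] [MeasurableSpace Y] [BorelSpace Y]
    {μ : Measure X} (hμ : InvProb Γ X μ) {ρ : Γ → G} (hρ : Function.Surjective ρ) {π : X → Y}
    (hπ : Continuous π) (hequiv : ∀ s x, π (s • x) = ρ s • π x) :
    InvProb G Y (μ.map π) := by
  have := hμ.1
  refine ⟨Measure.isProbabilityMeasure_map hπ.aemeasurable, fun g => ?_⟩
  obtain ⟨s, rfl⟩ := hρ g
  rw [Measure.map_map (continuous_const_smul _).measurable hπ.measurable]
  conv_rhs => rw [← hμ.2 s]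
  rw [Measure.map_map hπ.measurable (continuous_const_smul _).measurable]
  congr 1
  ext x
  exact (hequiv s x).symm

section Lift

variable {Γ : Type*} [Group Γ] (H : Subgroup Γ) [Finite H]

theorem finite_preimage_mk (S : Finset (Γ ⧸ H)) :
    ((QuotientGroup.mk : Γ → Γ ⧸ H) ⁻¹' (S : Set (Γ ⧸ H))).Finite := by
  have : Finite ((QuotientGroup.mk : Γ → Γ ⧸ H) ⁻¹' (S : Set (Γ ⧸ H))) :=
    Finite.of_equiv _ (QuotientGroup.preimageMkEquivSubgroupProdSet H _).symm
  exact Set.toFinite _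

/-- The full preimage in the group of a finite set of cosets of a finite subgroup. -/
noncomputable def cosetLift (S : Finset (Γ ⧸ H)) : Finset Γ := (finite_preimage_mk H S).toFinset

@[simp] theorem mem_cosetLift {S : Finset (Γ ⧸ H)} {s : Γ} :
    s ∈ cosetLift H S ↔ (QuotientGroup.mk s : Γ ⧸ H) ∈ S := by
  simp [cosetLift]

theorem card_cosetLift (S : Finset (Γ ⧸ H)) : (cosetLift H S).card = Nat.card H * S.card := by
  rw [cosetLift, ← Set.ncard_eq_toFinset_card _ (finite_preimage_mk H S),
    ← Nat.card_coe_set_eq, QuotientGroup.card_preimage_mk]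
  simp

theorem IsFolner.cosetLift [H.Normal] {K : Finset Γ} {L S : Finset (Γ ⧸ H)} {ε : ℝ}
    (hL : ∀ k ∈ K, (QuotientGroup.mk k : Γ ⧸ H) ∈ L) (h : IsFolner L S ε) :
    IsFolner K (cosetLift H S) ε := by
  classical
  unfold IsFolner at h ⊢
  have hsub : (K * Paper.cosetLift H S) \ Paper.cosetLift H S ⊆
      Paper.cosetLift H ((L * S) \ S) := by
    intro g hg
    obtain ⟨hg, hg'⟩ := Finset.mem_sdiff.mp hg
    obtain ⟨k, hk, s, hs, rfl⟩ := Finset.mem_mul.mp hg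
    rw [mem_cosetLift] at hs hg' ⊢
    exact Finset.mem_sdiff.mpr ⟨Finset.mul_mem_mul (hL k hk) hs, hg'⟩
  have hH : (0 : ℝ) < Nat.card H := by exact_mod_cast Nat.card_pos
  have hcard := Finset.card_le_card hsub
  rw [card_cosetLift] at hcard
  rw [card_cosetLift]
  have hcard' : ((((K * Paper.cosetLift H S) \ Paper.cosetLift H S).card : ℕ) : ℝ) ≤
      Nat.card H * ((L * S) \ S).card := by exact_mod_cast hcard
  push_cast
  have h' : (((L * S) \ S).card : ℝ) < ε * S.card := by convert h
  convert lt_of_le_of_lt hcard' (mul_lt_mul_of_pos_left h' hH) using 1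
  · congr!
  · ring

end Lift

end Paper

open Paper

theorem almostFiniteInMeasure_of_quotient_almostFinite
    (Γ : Type*) [Group Γ] [Countable Γ]
    (H : Subgroup Γ) [H.Normal] (hlf : LocallyFiniteGroup H)
    (X : Type*) [MetricSpace X] [CompactSpace X] [Infinite X]
    [MeasurableSpace X] [BorelSpace X]
    [MulAction Γ X] [ContinuousConstSMul Γ X]
    (hzd : TopologicalSpace.IsTopologicalBasis {s : Set X | IsClopen s})
    (hmin : Minimal Γ X) (hef : EssFree Γ X)
    (Y : Type*) [MetricSpace Y]
    [MulAction (Γ ⧸ H) Y] [ContinuousConstSMul (Γ ⧸ H) Y]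
    (π : X → Y) (hq : Topology.IsQuotientMap π)
    (hfib : ∀ x x' : X, π x = π x' ↔ x' ∈ MulAction.orbit H x)
    (hequiv : ∀ (s : Γ) (x : X), π (s • x) = (QuotientGroup.mk s : Γ ⧸ H) • π x)
    (hAF : AlmostFinite (Γ ⧸ H) Y) :
    AlmostFiniteInMeasure Γ X := by
  classical
  by_cases hne : ∃ μ : Measure X, InvProb Γ X μ
  swap
  · intro K ε hε
    have : IsEmpty {μ : Measure X // InvProb Γ X μ} := ⟨fun μ => hne ⟨μ.1, μ.2⟩⟩
    refine ⟨0, fun _ => ∅, fun _ => ∅, fun i => i.elim0, fun i => i.elim0, fun i => i.elim0,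
      fun i => i.elim0, ?_⟩
    simpa using hε
  obtain ⟨μ₀, hμ₀⟩ := hne
  obtain ⟨x₀, hx₀⟩ := exists_free_point hef hμ₀
  have hHfin : Finite H := by
    have hcl : IsClosed (MulAction.orbit H x₀) := by
      convert (isClosed_singleton (x := π x₀)).preimage hq.continuous
      ext x
      rw [← hfib, Set.mem_preimage, Set.mem_singleton_iff, eq_comm]
    have : ContinuousConstSMul H X := ⟨fun h => continuous_const_smul (h : Γ)⟩
    have := (finite_orbit_of_isClosed x₀ hcl).to_subtype
    refine Finite.of_injective (fun h : H => (⟨h • x₀, h, rfl⟩ : MulAction.orbit H x₀)) ?_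
    intro a b hab
    have hab' : (a : Γ) • x₀ = (b : Γ) • x₀ := congrArg Subtype.val hab
    by_contra hne
    refine hx₀ ((b : Γ)⁻¹ * a) (fun h => hne ?_) (by rw [mul_smul, hab', inv_smul_smul])
    exact Subtype.ext (inv_mul_eq_one.mp h).symm
  have hfree : ∀ h ∈ H, h ≠ 1 → ∀ x : X, h • x ≠ x := fun h hh h1 x =>
    hmin.free_of_finite_normal H hx₀ hh h1 x
  intro K ε hε
  obtain ⟨m, hm⟩ := exists_nat_one_div_lt hε
  obtain ⟨n, S, B, hS, hB, hSF, -, S', hS', hsub⟩ :=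
    hAF (K.image QuotientGroup.mk) (m + 1) m.succ_pos ε hε
  obtain ⟨d, D, hDo, hDd, hDH, hDX⟩ := exists_small_fundamental_domain hzd H hfree
    (Finset.univ.biUnion fun i => cosetLift H (S i)) hε
  let e : Fin (n * d) ≃ Fin n × Fin d := finProdFinEquiv.symm
  have hπs : ∀ (s : Γ) (i : Fin n) (A : Set X),
      s • (π ⁻¹' B i ∩ A) ⊆ π ⁻¹' ((QuotientGroup.mk s : Γ ⧸ H) • B i) := by
    rintro s i A _ ⟨y, hy, rfl⟩
    rw [Set.mem_preimage]
    simp only [hequiv]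
    exact Set.smul_mem_smul_set hy.1
  refine ⟨n * d, fun p => cosetLift H (S (e p).1), fun p => π ⁻¹' B (e p).1 ∩ D (e p).2, ?_,
    fun p => ((hB _).preimage hq.continuous).inter (hDo _),
    fun p => (hSF _).cosetLift H fun k hk => Finset.mem_image_of_mem _ hk,
    fun p s hs => hDd (e p).2 s (Finset.mem_biUnion.mpr ⟨_, Finset.mem_univ _, hs⟩) _
      Set.inter_subset_right, ?_⟩
  · intro p q s hs t ht hne
    rw [mem_cosetLift] at hs ht
    by_cases hst : ((e p).1, (QuotientGroup.mk s : Γ ⧸ H)) = ((e q).1, QuotientGroup.mk t)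
    · obtain ⟨h1, h2⟩ := Prod.ext_iff.mp hst
      have hmem : t⁻¹ * s ∈ H := QuotientGroup.eq.mp h2.symm
      have hdis : Disjoint ((t⁻¹ * s) • D (e p).2) (D (e q).2) := by
        refine hDH _ _ _ hmem fun h3 h4 => hne ?_
        rw [Prod.ext_iff]
        exact ⟨e.injective (Prod.ext h1 h3), (inv_mul_eq_one.mp h4).symm⟩
      rw [← Set.disjoint_smul_set (a := t), smul_smul, mul_inv_cancel_left] at hdis
      exact hdis.mono (Set.smul_set_mono Set.inter_subset_right)
        (Set.smul_set_mono Set.inter_subset_right)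
    · exact ((hS _ _ _ hs _ ht hst).preimage π).mono (hπs _ _ _) (hπs _ _ _)
  · have hcover : (Set.univ \ CastleUnion Γ X (fun p => cosetLift H (S (e p).1))
        fun p => π ⁻¹' B (e p).1 ∩ D (e p).2) ⊆
        π ⁻¹' (Set.univ \ CastleUnion (Γ ⧸ H) Y S B) := by
      rintro x ⟨-, hx⟩
      refine ⟨trivial, fun hy => hx ?_⟩
      simp only [CastleUnion, Set.mem_iUnion] at hy ⊢
      obtain ⟨i, s, hs, hxs⟩ := hy
      obtain ⟨s, rfl⟩ := QuotientGroup.mk_surjective s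
      obtain ⟨h, hh, k, hk⟩ := hDX (s⁻¹ • x)
      refine ⟨e.symm (i, k), s * h⁻¹, ?_, ?_⟩
      · simpa [QuotientGroup.mk_mul_of_mem _ (H.inv_mem hh)] using hs
      · rw [Set.mem_smul_set_iff_inv_smul_mem]
        have hx' : (s * h⁻¹)⁻¹ • x = h • s⁻¹ • x := by simp [mul_smul]
        rw [hx', Equiv.apply_symm_apply]
        refine ⟨?_, hk⟩
        have h1 : (QuotientGroup.mk h : Γ ⧸ H) = 1 := (QuotientGroup.eq_one_iff h).mpr hh
        rw [Set.mem_preimage, hequiv, h1, one_smul, hequiv, QuotientGroup.mk_inv]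
        exact Set.mem_smul_set_iff_inv_smul_mem.mp hxs
    let _ : MeasurableSpace Y := borel Y
    have : BorelSpace Y := ⟨rfl⟩
    have hbound : (((m + 1 : ℕ) : ENNReal))⁻¹ < ENNReal.ofReal ε := by
      rw [← ENNReal.ofReal_natCast, ← ENNReal.ofReal_inv_of_pos (by positivity)]
      refine (ENNReal.ofReal_lt_ofReal_iff hε).mpr ?_
      simpa using hm
    refine lt_of_le_of_lt (iSup_le fun μ => ?_) hbound
    refine le_trans (measure_mono hcover) (le_trans (Measure.le_map_apply
      hq.continuous.aemeasurable _) ?_)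
    exact hS.measure_compl_le (μ.2.map QuotientGroup.mk_surjective hq.continuous hequiv)
      m.succ_pos hB hS' hsub
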